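/- Suppose 2 ≤ s ≤ r − ⌊r/m⌋ − 1 and 0 ≤ k ≤ r − ⌊r/m⌋ − 1 − s. Set t_i = m − ⌈(k+i)·m/r⌉ for 1 ≤ i ≤ s. Then for all integers j_1, …, j_s with 1 ≤ j_i ≤ t_i for each i, every permutation of the s-tuple (m·k + j_1, j_2, …, j_s) is an arithmetic pure gap at the indices (1, 2, …, s). -/

import Mathlib

open Finset

/-- Floor of the rational number `x / m`. -/
noncomputable def fdivq (m : ℕ) (x : ℤ) : ℤ := ⌊(x : ℚ) / (m : ℚ)⌋

/-- The quantity `∑_{i=0}^{n-1} ⌊(a_i + t·λ_{c i})/m⌋ + ∑_{w ∉ range c} ⌊t·λ_w/m⌋`. -/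
noncomputable def gapSum (m r n : ℕ) (lam : Fin (r + 1) → ℤ)
    (c : Fin n → Fin (r + 1)) (a : Fin n → ℤ) (t : ℤ) : ℤ :=
  (∑ i : Fin n, fdivq m (a i + t * lam (c i))) +
    ∑ w ∈ Finset.univ \ Finset.image c Finset.univ, fdivq m (t * lam w)

/-- `(a 0, …, a (n-1))` is an *arithmetic pure gap* at the (pairwise distinct) indices
`c 0, …, c (n-1)` of `{0,…,r}`: the entries are nonnegative and for every
`t ∈ {0,…,m-1}` exactly one of the two Bartoli–Quoos–Zini conditions holds. -/
noncomputable def IsArithPureGap (m r n : ℕ) (lam : Fin (r + 1) → ℤ)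
    (c : Fin n → Fin (r + 1)) (a : Fin n → ℤ) : Prop :=
  (∀ i, 0 ≤ a i) ∧
    ∀ t : ℤ, 0 ≤ t → t ≤ (m : ℤ) - 1 →
      Xor' (gapSum m r n lam c a t < 0)
        (0 ≤ gapSum m r n lam c a t ∧
          ∀ i : Fin n, fdivq m (a i + t * lam (c i)) = fdivq m (a i + t * lam (c i) - 1))

theorem fdivq_eq_ediv (m : ℕ) (x : ℤ) : fdivq m x = x / m := by
  unfold fdivq
  exact Rat.floor_intCast_div_natCast x m

/-- At the finite indices `1, …, s` with equal multiplicities `l`, the gap sum depends on `t`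
only through the residue of `t * l` modulo `m`. -/
theorem gapSum_finite_eq {m r s : ℕ} (hm : 0 < m) (hsr : s ≤ r) {l : ℤ}
    {lam : Fin (r + 1) → ℤ} (hlam : ∀ i : Fin (r + 1), lam i = if i = 0 then -(r : ℤ) * l else l)
    (a : Fin s → ℤ) (t : ℤ) :
    gapSum m r s lam (fun i => Fin.castLE (Nat.succ_le_succ hsr) i.succ) a t =
      (∑ i, (a i + t * l % m) / m) + -((r : ℤ) * (t * l % m)) / m := by
  have hm0 : (m : ℤ) ≠ 0 := by exact_mod_cast hm.ne'
  have hdecomp := Int.mul_ediv_add_emod (t * l) m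
  set u := t * l % m
  set q := t * l / m
  set c : Fin s → Fin (r + 1) := fun i => Fin.castLE (Nat.succ_le_succ hsr) i.succ with hc
  have hcinj : Function.Injective c := fun i j h => by
    simpa [hc] using h
  have hc0 : ∀ i, lam (c i) = l := fun i => by
    rw [hlam, if_neg]
    simp [hc, Fin.ext_iff]
  have hsub := Finset.sum_sdiff (f := fun w => fdivq m (t * lam w))
    (Finset.subset_univ (Finset.image c Finset.univ))
  rw [Finset.sum_image hcinj.injOn, Fin.sum_univ_succ] at hsub
  have hinf : fdivq m (t * lam 0) = -(r * u) / m - r * q := by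
    rw [fdivq_eq_ediv, hlam, if_pos rfl, eq_sub_iff_add_eq, ← Int.add_mul_ediv_right _ _ hm0]
    congr 1
    linear_combination (r : ℤ) * hdecomp
  have hfin : ∀ i : Fin r, fdivq m (t * lam i.succ) = q := fun i => by
    rw [fdivq_eq_ediv, hlam, if_neg (Fin.succ_ne_zero i)]
  have hshift : ∀ i, fdivq m (a i + t * lam (c i)) = (a i + u) / m + q := fun i => by
    rw [fdivq_eq_ediv, hc0, ← Int.add_mul_ediv_right _ _ hm0]
    congr 1
    linear_combination -hdecomp
  have himg : ∀ i, fdivq m (t * lam (c i)) = q := fun i => by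
    rw [fdivq_eq_ediv, hc0]
  simp only [hinf, hfin, himg, Finset.sum_const, Finset.card_univ, Fintype.card_fin,
    nsmul_eq_mul] at hsub
  simp only [gapSum, hshift, Finset.sum_add_distrib, Finset.sum_const, Finset.card_univ,
    Fintype.card_fin, nsmul_eq_mul]
  linarith

theorem dvd_of_fdivq_ne_fdivq_sub_one {m : ℕ} (hm : 0 < m) {x : ℤ}
    (h : fdivq m x ≠ fdivq m (x - 1)) : (m : ℤ) ∣ x := by
  have hm' : (0 : ℤ) < m := by exact_mod_cast hm
  by_contra hx
  apply h
  rw [fdivq_eq_ediv, fdivq_eq_ediv]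
  have hdecomp := Int.mul_ediv_add_emod x m
  have hpos : 0 < x % m :=
    lt_of_le_of_ne (Int.emod_nonneg _ hm'.ne') fun h0 => hx (Int.dvd_of_emod_eq_zero h0.symm)
  have hlt := Int.emod_lt_of_pos x hm'
  symm
  rw [Int.ediv_eq_iff_of_pos hm']
  constructor <;> nlinarith

/-- A family of consecutive pure gaps at the finite indices `(1,…,s)` for equal
multiplicities (Proposition precisefamily1). -/
theorem consecutive_pureGaps_finite (m r : ℕ) (hm : 2 ≤ m) (hr : 1 ≤ r)
    (l : ℤ) (hl : l ≠ 0) (hgcd : Int.gcd (m : ℤ) ((r : ℤ) * l) = 1)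
    (lam : Fin (r + 1) → ℤ)
    (hlam : ∀ i : Fin (r + 1), lam i = if i = 0 then -(r : ℤ) * l else l)
    (s : ℕ) (hsr : s ≤ r) (hs1 : 2 ≤ s)
    (hs2 : (s : ℤ) ≤ (r : ℤ) - ⌊(r : ℚ) / (m : ℚ)⌋ - 1)
    (k : ℕ) (hk : (k : ℤ) ≤ (r : ℤ) - ⌊(r : ℚ) / (m : ℚ)⌋ - 1 - (s : ℤ))
    (jj : Fin s → ℤ)
    (hjj : ∀ i : Fin s, 1 ≤ jj i ∧
      jj i ≤ (m : ℤ) - ⌈(((k : ℚ) + ((i : ℕ) : ℚ) + 1) * (m : ℚ)) / (r : ℚ)⌉)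
    (b : Fin s → ℤ)
    (hb : ∀ i : Fin s, b i = if (i : ℕ) = 0 then (m : ℤ) * (k : ℤ) + jj i else jj i)
    (σ : Equiv.Perm (Fin s)) :
    IsArithPureGap m r s lam
      (fun i => Fin.castLE (Nat.succ_le_succ hsr) i.succ) (fun i => b (σ i)) := by
  have hm' : (0 : ℤ) < m := by omega
  have hr' : (0 : ℤ) < r := by omega
  have hlower : ∀ (i : Fin s) (u : ℤ), m ≤ jj i + u → ((k : ℤ) + (i : ℕ) + 1) * m ≤ r * u := by
    intro i u hu
    have hceil : ⌈(((k : ℚ) + ((i : ℕ) : ℚ) + 1) * (m : ℚ)) / (r : ℚ)⌉ ≤ u := by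
      linarith [(hjj i).2]
    rw [Int.ceil_le, div_le_iff₀ (by exact_mod_cast hr')] at hceil
    rw [mul_comm (r : ℤ)]
    exact_mod_cast hceil
  have hjlt : ∀ i, jj i < m := fun i => by
    by_contra! hi
    have := hlower i 0 (by simpa using hi)
    have : 0 < ((k : ℤ) + (i : ℕ) + 1) * m := by positivity
    linarith
  refine ⟨fun i => ?_, fun t _ _ => ?_⟩
  · have := (hjj (σ i)).1
    have : 0 ≤ (m : ℤ) * k := by positivity
    change 0 ≤ b (σ i)
    rw [hb]
    split_ifs <;> linarith
  rw [gapSum_finite_eq (by omega) hsr hlam, Equiv.sum_comp σ fun i => (b i + t * l % m) / m]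
  have hu0 := Int.emod_nonneg (t * l) hm'.ne'
  have hum := Int.emod_lt_of_pos (t * l) hm'
  have hdecomp := Int.mul_ediv_add_emod (t * l) m
  set u := t * l % m
  set S := (∑ i, (b i + u) / m) + -((r : ℤ) * u) / m with hS
  by_cases hneg : S < 0
  · exact Or.inl ⟨hneg, fun h => absurd h.1 (not_le.2 hneg)⟩
  refine Or.inr ⟨⟨not_lt.1 hneg, fun i => ?_⟩, hneg⟩
  by_contra hi
  apply hneg
  have hdvd := dvd_of_fdivq_ne_fdivq_sub_one (by omega) hi
  have hci : lam (Fin.castLE (Nat.succ_le_succ hsr) i.succ) = l := by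
    rw [hlam, if_neg]
    simp [Fin.ext_iff]
  have hdvd' : (m : ℤ) ∣ jj (σ i) + u := by
    beta_reduce at hdvd
    rw [hci, ← hdecomp, hb] at hdvd
    obtain ⟨w, hw⟩ := hdvd
    split_ifs at hw
    · exact ⟨w - k - t * l / m, by linear_combination hw⟩
    · exact ⟨w - t * l / m, by linear_combination hw⟩
  have hmem : (m : ℤ) ≤ jj (σ i) + u :=
    Int.le_of_dvd (by linarith [(hjj (σ i)).1]) hdvd'
  have hu : 0 < u := by linarith [hjlt (σ i)]
  set A : Finset (Fin s) := {i | (m : ℤ) ≤ jj i + u} with hA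
  obtain ⟨N, hN, hNmax⟩ := A.exists_max_image id ⟨σ i, by simpa [hA] using hmem⟩
  have hcard : A.card ≤ (N : ℕ) + 1 := by
    rw [← Fin.card_Iic]
    exact Finset.card_le_card fun x hx => Finset.mem_Iic.2 (hNmax x hx)
  have hterm : ∀ i, (b i + u) / m = (if (i : ℕ) = 0 then (k : ℤ) else 0) +
      if (m : ℤ) ≤ jj i + u then 1 else 0 := fun i => by
    rw [Int.ediv_eq_iff_of_pos hm', hb]
    have := (hjj i).1
    have := hjlt i
    split_ifs <;> constructor <;> linarith
  have hk_sum : ∑ i : Fin s, (if (i : ℕ) = 0 then (k : ℤ) else 0) = k := by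
    rw [Finset.sum_eq_single ⟨0, by omega⟩] <;> simp +contextual [Fin.ext_iff]
  have hA_sum : ∑ i : Fin s, (if (m : ℤ) ≤ jj i + u then (1 : ℤ) else 0) = A.card := by
    simp [hA]
  have hstrict : ((k : ℤ) + (N : ℕ) + 1) * m < r * u := by
    refine lt_of_le_of_ne (hlower N u (by simpa [hA] using hN)) fun heq => ?_
    have hcop : IsCoprime (m : ℤ) r :=
      (Int.isCoprime_iff_gcd_eq_one.2 hgcd).of_mul_right_left
    have hdvd_mul : (m : ℤ) ∣ r * u := ⟨_, heq.symm.trans (mul_comm _ _)⟩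
    exact hum.not_ge (Int.le_of_dvd hu (hcop.dvd_of_dvd_mul_left hdvd_mul))
  have hinf : -((r : ℤ) * u) / m < -((k : ℤ) + (N : ℕ) + 1) := by
    rw [Int.ediv_lt_iff_lt_mul hm']
    linarith
  rw [hS, Finset.sum_congr rfl fun i _ => hterm i, Finset.sum_add_distrib, hk_sum, hA_sum]
  have : (A.card : ℤ) ≤ (N : ℕ) + 1 := by exact_mod_cast hcard
  linarith
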